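/- arXiv:math/0511275 — 3 statements merged into one kernel-verified Lean document; each statement's English description precedes it below -/
import Mathlib

section
/- Let G be a finitely generated residually free group and let g_1, ..., g_m be finitely many nontrivial elements of G. Then there exists a finite-index subgroup K of G such that every element k of K of the form k = t * g_i^n * t^{-1} (for some index i, some t in G, and some nonzero integer n) has infinite order in H_1(K); that is, the image of k under the abelianization map of K is not of finite order. -/
theorem Subgroup.FiniteIndex.comap_hom {G F : Type*} [Group G] [Group F] {H : Subgroup F}
    (hH : H.FiniteIndex) (f : G →* F) : (H.comap f).FiniteIndex := by
  refine ⟨?_⟩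
  rw [Subgroup.index_comap]
  exact (Subgroup.instFiniteIndex_subgroupOf H f.range).index_ne_zero

namespace FreeGroup

/-- The wreath product of `Multiplicative ℤ` with the symmetric group of `X`. -/
abbrev IntWreath (X : Type*) : Type _ :=
  (X → Multiplicative ℤ) ⋊[mulAutArrow (G := Equiv.Perm X) (A := X) (M := Multiplicative ℤ)]
    Equiv.Perm X

theorem IntWreath.mul_left_apply {X : Type*} (a b : IntWreath X) (x : X) :
    (a * b).left x = a.left x * b.left (a.right⁻¹ x) := rfl

theorem IntWreath.inv_left_apply {X : Type*} (a : IntWreath X) (x : X) :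
    a⁻¹.left x = (a.left (a.right x))⁻¹ := by
  simp [SemidirectProduct.inv_left]
  rfl

/-- The elements of the wreath product whose permutation fixes `x`. -/
def IntWreath.stabilizer {X : Type*} (x : X) : Subgroup (IntWreath X) :=
  (MulAction.stabilizer (Equiv.Perm X) x).comap SemidirectProduct.rightHom

theorem IntWreath.mem_stabilizer {X : Type*} {x : X} {a : IntWreath X} :
    a ∈ stabilizer x ↔ a.right x = x := Iff.rfl

instance {X : Type*} [Finite X] (x : X) : (IntWreath.stabilizer x).FiniteIndex :=
  Subgroup.FiniteIndex.comap_hom inferInstance _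

/-- Evaluation at a fixed point is a homomorphism on its stabilizer. -/
def IntWreath.evalStabilizer {X : Type*} (x : X) : stabilizer x →* Multiplicative ℤ where
  toFun a := a.1.left x
  map_one' := rfl
  map_mul' a b := by
    have h : a.1.right⁻¹ x = x := by
      rw [Equiv.Perm.inv_eq_iff_eq]
      exact (mem_stabilizer.1 a.2).symm
    rw [Subgroup.coe_mul, mul_left_apply, h]

theorem IntWreath.prod_map_range {l : ℕ} (e : ZMod l → IntWreath (ZMod l))
    (hr : ∀ x, (e x).right (x + 1) = x) (hl : ∀ x, (e x).left x = Multiplicative.ofAdd 1) (k : ℕ) :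
    ((List.range k).map fun i : ℕ => e i).prod.right k = 0 ∧
      ((List.range k).map fun i : ℕ => e i).prod.left 0 = Multiplicative.ofAdd (k : ℤ) := by
  induction k with
  | zero => exact ⟨by simp, rfl⟩
  | succ k ih =>
    obtain ⟨ih₁, ih₂⟩ := ih
    rw [List.range_succ, List.map_append, List.prod_append, List.map_singleton,
      List.prod_singleton]
    refine ⟨?_, ?_⟩
    · rw [SemidirectProduct.mul_right, Equiv.Perm.mul_apply, Nat.cast_succ, hr, ih₁]
    · have h : ((List.range k).map fun i : ℕ => e i).prod.right⁻¹ 0 = k := by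
        rw [Equiv.Perm.inv_eq_iff_eq, ih₁]
      rw [mul_left_apply, h, hl, ih₂, ← ofAdd_add, Nat.cast_succ]

/-- A cyclic word without cancelling neighbours is read along the edges of a cycle by a suitable
action of the free group on the vertices of that cycle. -/
theorem exists_perm_of_cyclic_word {α : Type*} {l : ℕ} [NeZero l] (u : ZMod l → α × Bool)
    (hu : ∀ x, (u x).1 = (u (x + 1)).1 → (u x).2 = (u (x + 1)).2) (a : α) :
    ∃ σ : Equiv.Perm (ZMod l), (∀ x, u x = (a, true) → σ (x + 1) = x) ∧
      ∀ x, u x = (a, false) → σ x = x + 1 := by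
  classical
  have hu₁ : ∀ x, u x = (a, true) → u (x + 1) ≠ (a, false) := by
    intro x h h'
    simpa [h, h'] using hu x
  have hu₂ : ∀ x, u x = (a, false) → u (x + 1) ≠ (a, true) := by
    intro x h h'
    simpa [h, h'] using hu x
  let s : Finset (ZMod l) := {x | u (x - 1) = (a, true) ∨ u x = (a, false)}
  let f : ZMod l → ZMod l := fun x => if u x = (a, false) then x + 1 else x - 1
  have hf : Set.InjOn f s := by
    intro x hx y hy hxy
    simp only [s, Finset.coe_filter, Finset.mem_univ, true_and, Set.mem_ofPred_eq] at hx hy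
    simp only [f] at hxy
    split_ifs at hxy with h₁ h₂ h₂
    · exact add_right_cancel hxy
    · have := hu₂ x h₁
      rw [hxy] at this
      tauto
    · have := hu₂ y h₂
      rw [← hxy] at this
      tauto
    · exact sub_left_injective hxy
  obtain ⟨σ, hσ⟩ := Finset.exists_equiv_extend_of_card_eq (α := ZMod l) (β := ZMod l)
    (t := Finset.univ) (by simp) (s := s) (f := f) (Finset.subset_univ _) hf
  refine ⟨σ.trans (Equiv.subtypeUnivEquiv (by simp)), fun x hx => ?_, fun x hx => ?_⟩
  · refine (hσ (x + 1) (by simp [s, hx])).trans ?_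
    simp [f, hu₁ x hx]
  · refine (hσ x (by simp [s, hx])).trans ?_
    simp [f, hx]

theorem exists_hom_intWreath_of_cyclic_word {α : Type*} {l : ℕ} [NeZero l] (u : ZMod l → α × Bool)
    (hu : ∀ x, (u x).1 = (u (x + 1)).1 → (u x).2 = (u (x + 1)).2) :
    ∃ e : α → IntWreath (ZMod l), ∀ x,
      (cond (u x).2 (e (u x).1) (e (u x).1)⁻¹).right (x + 1) = x ∧
      (cond (u x).2 (e (u x).1) (e (u x).1)⁻¹).left x = Multiplicative.ofAdd 1 := by
  classical
  choose σ hσ₁ hσ₂ using exists_perm_of_cyclic_word u hu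
  refine ⟨fun a => ⟨fun x => Multiplicative.ofAdd (if u x = (a, true) then 1 else -1), σ a⟩,
    fun x => ?_⟩
  obtain ⟨⟨a, b⟩, hx⟩ : ∃ p, u x = p := ⟨_, rfl⟩
  cases b with
  | true => simp [hx, hσ₁ a x hx]
  | false =>
    have h : u (x + 1) ≠ (a, true) := by
      intro h'
      simpa [hx, h'] using hu x
    simp only [hx, cond_false]
    rw [IntWreath.inv_left_apply, SemidirectProduct.inv_right, Equiv.Perm.inv_eq_iff_eq]
    simp [hσ₂ a x hx, h]

theorem IsCyclicallyReduced.exists_finiteIndex {α : Type*} {L : List (α × Bool)}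
    (hL : IsCyclicallyReduced L) (hne : L ≠ []) :
    ∃ (M : Subgroup (FreeGroup α)) (φ : M →* Multiplicative ℤ) (hv : mk L ∈ M),
      M.FiniteIndex ∧ φ ⟨mk L, hv⟩ ≠ 1 := by
  have hpos : 0 < L.length := List.length_pos_iff.2 hne
  have : NeZero L.length := ⟨hpos.ne'⟩
  let u : ZMod L.length → α × Bool := fun x => L[x.val]'(ZMod.val_lt x)
  have hu : ∀ x, (u x).1 = (u (x + 1)).1 → (u x).2 = (u (x + 1)).2 := by
    intro x
    have hlt := ZMod.val_lt x
    by_cases h : x.val + 1 < L.length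
    · have hv : (x + 1).val = x.val + 1 := by
        conv_lhs => rw [← ZMod.natCast_zmod_val x, ← Nat.cast_succ]
        exact ZMod.val_natCast_of_lt h
      simp only [u, hv]
      exact List.isChain_iff_getElem.1 hL.1 _ h
    · have hv : (x + 1).val = 0 := by
        have h1 : x.val + 1 = L.length := by omega
        rw [← ZMod.natCast_zmod_val x, ← Nat.cast_succ, Nat.succ_eq_add_one, h1]
        simp
      have hx : x.val = L.length - 1 := by omega
      simp only [u, hv, hx]
      refine hL.2 _ ?_ _ ?_
      · simp [List.getLast?_eq_getElem?]
      · simp [List.head?_eq_getElem?]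
  obtain ⟨e, he⟩ := exists_hom_intWreath_of_cyclic_word u hu
  have hlift : lift e (mk L) = ((List.range L.length).map fun i : ℕ =>
      (fun x => cond (u x).2 (e (u x).1) (e (u x).1)⁻¹) (i : ZMod L.length)).prod := by
    rw [lift_mk]
    congr 1
    refine List.ext_getElem (by simp) fun i h₁ h₂ => ?_
    have hi : i < L.length := by simpa using h₁
    simp [u, ZMod.val_natCast, Nat.mod_eq_of_lt hi]
  obtain ⟨hr, hl⟩ := IntWreath.prod_map_range _ (fun x => (he x).1) (fun x => (he x).2) L.length
  rw [← hlift] at hr hl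
  rw [ZMod.natCast_self] at hr
  refine ⟨(IntWreath.stabilizer 0).comap (lift e),
    (IntWreath.evalStabilizer 0).comp ((lift e).subgroupComap _), hr,
    Subgroup.FiniteIndex.comap_hom inferInstance _, ?_⟩
  change (lift e (mk L)).left 0 ≠ 1
  rw [hl, Ne, ofAdd_eq_one]
  exact_mod_cast hpos.ne'

/-- Every nontrivial element of a free group has a conjugate lying in a finite index subgroup
and surviving in an infinite cyclic quotient of that subgroup. -/
theorem exists_finiteIndex_conj_map_ne_one {α : Type*} {w : FreeGroup α} (hw : w ≠ 1) :
    ∃ (M : Subgroup (FreeGroup α)) (φ : M →* Multiplicative ℤ) (s : FreeGroup α)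
      (hv : s⁻¹ * w * s ∈ M), M.FiniteIndex ∧ φ ⟨s⁻¹ * w * s, hv⟩ ≠ 1 := by
  classical
  have hc : w = mk (reduceCyclically.conjugator w.toWord) *
      mk (reduceCyclically w.toWord) * (mk (reduceCyclically.conjugator w.toWord))⁻¹ := by
    rw [inv_mk, mul_mk, mul_mk, reduceCyclically.conj_conjugator_reduceCyclically, mk_toWord]
  have hne : reduceCyclically w.toWord ≠ [] := by
    intro h
    rw [h, ← one_eq_mk, mul_one, mul_inv_cancel] at hc
    exact hw hc
  obtain ⟨M, φ, hv, hM, hφ⟩ :=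
    (reduceCyclically.isCyclicallyReduced isReduced_toWord).exists_finiteIndex hne
  have key : (mk (reduceCyclically.conjugator w.toWord))⁻¹ * w *
      mk (reduceCyclically.conjugator w.toWord) = mk (reduceCyclically w.toWord) := by
    nth_rw 2 [hc]
    group
  refine ⟨M, φ, mk (reduceCyclically.conjugator w.toWord), key ▸ hv, hM, ?_⟩
  simpa only [key] using hφ

end FreeGroup

/-- If `v` survives in a torsion-free abelian quotient of `M`, then the conjugates of nonzero powers
of `v` have infinite order in the abelianization of every subgroup mapping to the core of `M`. -/
theorem Abelianization.not_isOfFinOrder_of_le_comap_normalCore {G F : Type*} [Group G] [Group F]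
    (f : G →* F) {M : Subgroup F} (φ : M →* Multiplicative ℤ) {g t : G} {s : F}
    (hv : s⁻¹ * f g * s ∈ M) (hφ : φ ⟨s⁻¹ * f g * s, hv⟩ ≠ 1) {K : Subgroup G}
    (hK : K ≤ M.normalCore.comap f) {n : ℤ} (hn : n ≠ 0) (hk : t * g ^ n * t⁻¹ ∈ K) :
    ¬ IsOfFinOrder (Abelianization.of (⟨t * g ^ n * t⁻¹, hk⟩ : K)) := by
  intro hfin
  let c : F →* F := (MulAut.conj (f t * s)⁻¹).toMonoidHom
  have hc : ∀ k : K, (c.comp (f.comp K.subtype)) k ∈ M := fun k => hK k.2 (f t * s)⁻¹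
  let χ : K →* Multiplicative ℤ := φ.comp ((c.comp (f.comp K.subtype)).codRestrict M hc)
  have hval : χ ⟨t * g ^ n * t⁻¹, hk⟩ = φ ⟨s⁻¹ * f g * s, hv⟩ ^ n := by
    rw [← map_zpow]
    refine congrArg φ (Subtype.ext ?_)
    have hpow : (s⁻¹ * f g * s) ^ n = s⁻¹ * f g ^ n * s := by
      simpa using conj_zpow (i := n) (a := s⁻¹) (b := f g)
    change (f t * s)⁻¹ * f (t * g ^ n * t⁻¹) * ((f t * s)⁻¹)⁻¹ = (s⁻¹ * f g * s) ^ n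
    rw [hpow, map_mul, map_mul, map_inv, map_zpow]
    group
  have h := (Abelianization.lift χ).isOfFinOrder hfin
  rw [Abelianization.lift_apply_of, hval, isOfFinOrder_iff_eq_one] at h
  exact hφ ((IsMulTorsionFree.zpow_eq_one_iff_left hn).1 h)

/-- Let `G` be a finitely generated residually free group and let
`g 1, ..., g m` be finitely many nontrivial elements of `G`.  Then there exists a
finite-index subgroup `K` of `G` such that every element `k ∈ K` of the form
`k = t * (g i)^n * t⁻¹` (with `n` a nonzero integer) has infinite order in `H₁(K)`,
i.e. its image in the abelianization of `K` is not of finite order. -/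
theorem finite_index_subgroup_conjugate_powers_infinite_order_in_abelianization
    {G : Type*} [Group G] (hfg : Group.FG G)
    (hrf : ∀ g : G, g ≠ 1 → ∃ f : G →* FreeGroup (Fin 2), f g ≠ 1)
    (m : ℕ) (g : Fin m → G) (hg : ∀ i, g i ≠ 1) :
    ∃ K : Subgroup G, K.FiniteIndex ∧
      ∀ (i : Fin m) (t : G) (n : ℤ), n ≠ 0 →
        ∀ hk : t * (g i) ^ n * t⁻¹ ∈ K,
          ¬ IsOfFinOrder (Abelianization.of (⟨t * (g i) ^ n * t⁻¹, hk⟩ : K)) := by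
  choose f hf using fun i => hrf (g i) (hg i)
  choose M φ s hv hM hφ using fun i => FreeGroup.exists_finiteIndex_conj_map_ne_one (hf i)
  refine ⟨⨅ i, (M i).normalCore.comap (f i), Subgroup.finiteIndex_iInf fun i =>
    have := hM i
    Subgroup.FiniteIndex.comap_hom inferInstance _,
    fun i t n hn hk => ?_⟩
  exact Abelianization.not_isOfFinOrder_of_le_comap_normalCore (f i) (φ i) (hv i) (hφ i)
    (iInf_le _ i) hn hk
end

section
/- Let G be a finitely generated residually free group and let g_1, ..., g_m be finitely many nontrivial elements of G. Then there exist a finite-index subgroup K of G, a prime p ≥ 3, and a group homomorphism φ from K to ℤ/pℤ such that for every index i and every t in G: there exists a positive integer n with t * g_i^n * t^{-1} in K, and if n is the least such positive integer, then φ(t * g_i^n * t^{-1}) is nonzero. -/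
open PowerSeries in
theorem PowerSeries.dvd_coeff_mul {A : Type*} [Ring A] {c : A} {u v : A⟦X⟧} {a : ℕ}
    (h : ∀ i j, i + j = a → c ∣ coeff i u * coeff j v) : c ∣ coeff a (u * v) := by
  rw [coeff_mul]
  exact Finset.dvd_sum fun x hx => h _ _ (Finset.HasAntidiagonal.mem_antidiagonal.1 hx)

theorem Nat.cast_dvd_mul_of_dvd_right {A : Type*} [Ring A] {n : ℕ} {b : A} (c : A)
    (h : (n : A) ∣ b) : (n : A) ∣ c * b := by
  obtain ⟨d, rfl⟩ := h
  exact ⟨c * d, by rw [← mul_assoc, ← (Nat.cast_commute n c).eq, mul_assoc]⟩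

theorem AddMonoidHom.natCast_dvd_map {A : Type*} [Ring A] (l : A →+ ℤ) {n : ℕ} {x : A}
    (h : (n : A) ∣ x) : (n : ℤ) ∣ l x := by
  obtain ⟨d, rfl⟩ := h
  exact ⟨l d, by rw [← nsmul_eq_mul, map_nsmul, nsmul_eq_mul]⟩

namespace PowerSeries

variable {A : Type*} [Ring A]

theorem coeff_mul_of_forall_lt_right {u v : A⟦X⟧} {l a : ℕ} (hv : ∀ i < l, coeff i v = 0)
    (ha : a ≤ l) : coeff a (u * v) = coeff 0 u * coeff a v := by
  rw [coeff_mul, Finset.sum_eq_single (0, a)]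
  · rintro ⟨i, j⟩ hij hne
    have hij : i + j = a := Finset.HasAntidiagonal.mem_antidiagonal.1 hij
    have : j ≠ a := by rintro rfl; apply hne; ext <;> simp; omega
    rw [hv j (by omega), mul_zero]
  · simp

theorem coeff_mul_of_forall_lt_left {u v : A⟦X⟧} {l a : ℕ} (hu : ∀ i < l, coeff i u = 0)
    (ha : a ≤ l) : coeff a (u * v) = coeff a u * coeff 0 v := by
  rw [coeff_mul, Finset.sum_eq_single (a, 0)]
  · rintro ⟨i, j⟩ hij hne
    have hij : i + j = a := Finset.HasAntidiagonal.mem_antidiagonal.1 hij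
    have : i ≠ a := by rintro rfl; apply hne; ext <;> simp; omega
    rw [hu i (by omega), zero_mul]
  · simp

theorem coeff_pow_sub_one {u : A⟦X⟧} {l a : ℕ} (hl : 1 ≤ l)
    (hu : ∀ i < l, coeff i (u - 1) = 0) (ha : a ≤ l) (n : ℕ) :
    coeff a (u ^ n - 1) = (n : A) * coeff a (u - 1) := by
  have h0 : ∀ n, coeff 0 (u ^ n) = 1 := fun n => by
    have h := hu 0 hl
    rw [map_sub, sub_eq_zero] at h
    have h1 : coeff 0 (1 : A⟦X⟧) = 1 := by simp
    rw [h1] at h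
    rw [coeff_zero_eq_constantCoeff_apply] at h ⊢
    rw [map_pow, h, one_pow]
  induction n with
  | zero => simp
  | succ n ih =>
    have : u ^ (n + 1) - 1 = (u ^ n - 1) + u ^ n * (u - 1) := by rw [pow_succ]; noncomm_ring
    rw [this, map_add, ih, coeff_mul_of_forall_lt_right hu ha, h0]
    push_cast
    rw [add_mul, one_mul]

theorem dvd_coeff_prime_pow_pow_sub_one {u : A⟦X⟧} (hu : coeff 0 u = 1) {p : ℕ} (hp : p.Prime)
    (w : ℕ) {a : ℕ} (ha : a < p) : ((p ^ w : ℕ) : A) ∣ coeff a (u ^ p ^ w - 1) := by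
  have hy : constantCoeff (u - 1) = 0 := by
    rw [map_sub, map_one, ← coeff_zero_eq_constantCoeff_apply, hu, sub_self]
  have hu' : u ^ p ^ w = (u - 1 + 1) ^ p ^ w := by rw [sub_add_cancel]
  rw [hu', (Commute.one_right (u - 1)).add_pow, Finset.sum_range_succ', add_sub_assoc]
  simp only [one_pow, mul_one, pow_zero, Nat.choose_zero_right, Nat.cast_one, sub_self, add_zero]
  rw [map_sum]
  refine Finset.dvd_sum fun k _ => ?_
  rw [← Nat.cast_comm, ← nsmul_eq_mul, map_nsmul, nsmul_eq_mul]
  rcases lt_or_ge a (k + 1) with h | h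
  · rw [coeff_of_lt_order a, mul_zero]
    · exact dvd_zero _
    · exact lt_of_lt_of_le (by exact_mod_cast h)
        (le_order_pow_of_constantCoeff_eq_zero (k + 1) hy)
  · have hpos : 0 < p ^ w := pow_pos hp.pos _
    have hd : p ^ w ∣ (p ^ w).choose (k + 1) := by
      have h1 := Nat.add_one_mul_choose_eq (p ^ w - 1) k
      rw [Nat.sub_add_cancel hpos] at h1
      have hc : Nat.Coprime (p ^ w) (k + 1) :=
        Nat.Coprime.pow_left _ <| hp.coprime_iff_not_dvd.2 <|
          Nat.not_dvd_of_pos_of_lt k.succ_pos (by omega)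
      exact hc.dvd_of_dvd_mul_right ⟨_, h1.symm⟩
    exact Dvd.dvd.mul_right (by exact_mod_cast Nat.cast_dvd_cast hd) _

end PowerSeries

open PowerSeries

section Dilation

variable {G A : Type*} [Group G] [Ring A] (ρ : G →* A⟦X⟧) (p D : ℕ)

theorem dvd_coeff_sub_one_mul {c : A} {u v : A⟦X⟧} (hu : coeff 0 u = 1) {a : ℕ}
    (h : ∀ i j, 1 ≤ i → i + j = a → c ∣ coeff i u ∨ coeff j v = 0) :
    c ∣ coeff a ((u - 1) * v) := by
  refine dvd_coeff_mul fun i j hij => ?_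
  rcases Nat.eq_zero_or_pos i with rfl | hi
  · rw [map_sub, hu, coeff_zero_one, sub_self, zero_mul]
    exact dvd_zero _
  · rcases h i j hi hij with h | h
    · have : coeff i (u - 1) = coeff i u := by
        rw [map_sub, coeff_one, if_neg hi.ne', sub_zero]
      rw [this]
      exact h.mul_right _
    · simp [h]

/-- The elements `g` such that the `a`-th coefficient of `ρ g` is divisible by `p ^ (D - a)`
for all `a ≥ 1`. -/
def dilationSubgroup (hρ : ∀ g, coeff 0 (ρ g) = 1) : Subgroup G where
  carrier := {g | ∀ a, 1 ≤ a → ((p ^ (D - a) : ℕ) : A) ∣ coeff a (ρ g)}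
  one_mem' a ha := by
    rw [map_one, coeff_one, if_neg (by omega)]
    exact dvd_zero _
  mul_mem' {g h} hg hh a ha := by
    have : ρ (g * h) = (ρ g - 1) * ρ h + ρ h := by rw [map_mul]; noncomm_ring
    rw [this, map_add]
    refine dvd_add (dvd_coeff_sub_one_mul (hρ g)
      fun i j hi hij => Or.inl ?_) (hh a ha)
    exact (Nat.cast_dvd_cast (pow_dvd_pow p (by omega))).trans (hg i hi)
  inv_mem' {g} hg a ha := by
    have : ρ g⁻¹ = 1 - (ρ g - 1) * ρ g⁻¹ := by
      rw [sub_mul, ← map_mul, mul_inv_cancel, map_one]; noncomm_ring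
    rw [this, map_sub, coeff_one, if_neg (by omega)]
    refine dvd_sub (dvd_zero _) (dvd_coeff_sub_one_mul (hρ g)
      fun i j hi hij => Or.inl ?_)
    exact (Nat.cast_dvd_cast (pow_dvd_pow p (by omega))).trans (hg i hi)

variable {ρ p D} {hρ : ∀ g, coeff 0 (ρ g) = 1}

theorem mem_dilationSubgroup {g : G} : g ∈ dilationSubgroup ρ p D hρ ↔
    ∀ a, 1 ≤ a → ((p ^ (D - a) : ℕ) : A) ∣ coeff a (ρ g) := Iff.rfl

theorem dilationSubgroup_finiteIndex [Module.Free ℤ A] [Module.Finite ℤ A] (hp : p ≠ 0) :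
    (dilationSubgroup ρ p D hρ).FiniteIndex := by
  let b := Module.Free.chooseBasis ℤ A
  have : NeZero (p ^ D) := ⟨pow_ne_zero _ hp⟩
  let F : G → Fin D → Module.Free.ChooseBasisIndex ℤ A → ZMod (p ^ D) :=
    fun g a k => (b.repr (coeff a (ρ g)) k : ZMod (p ^ D))
  have hF : ∀ g h, F g = F h → g⁻¹ * h ∈ dilationSubgroup ρ p D hρ := by
    intro g h hgh a ha
    rcases lt_or_ge a D with haD | haD
    · have hdvd : ∀ i < D, ((p ^ D : ℕ) : A) ∣ coeff i (ρ h - ρ g) := by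
        intro i hi
        have hk : ∀ k, ((p ^ D : ℕ) : ℤ) ∣ b.repr (coeff i (ρ h - ρ g)) k := by
          intro k
          have := congrFun (congrFun hgh ⟨i, hi⟩) k
          have := (ZMod.intCast_eq_intCast_iff_dvd_sub _ _ _).1 this
          simpa using this
        choose c hc using hk
        refine ⟨∑ k, c k • b k, ?_⟩
        rw [← b.sum_repr (coeff i (ρ h - ρ g)), Finset.mul_sum]
        refine Finset.sum_congr rfl fun k _ => ?_
        rw [hc, mul_smul, ← nsmul_eq_mul, natCast_zsmul]
      have : ρ (g⁻¹ * h) = 1 + ρ g⁻¹ * (ρ h - ρ g) := by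
        rw [mul_sub, ← map_mul, ← map_mul, inv_mul_cancel, map_one]; noncomm_ring
      rw [this, map_add, coeff_one, if_neg (by omega), zero_add]
      refine (Nat.cast_dvd_cast (pow_dvd_pow p (Nat.sub_le D a))).trans (dvd_coeff_mul ?_)
      intro i j hij
      exact Nat.cast_dvd_mul_of_dvd_right _ (hdvd j (by omega))
    · simp [Nat.sub_eq_zero_of_le haD]
  have : Finite (G ⧸ dilationSubgroup ρ p D hρ) := by
    refine Finite.of_injective
      (fun q : G ⧸ dilationSubgroup ρ p D hρ => F q.out) fun q r h => ?_
    rw [← q.out_eq', ← r.out_eq']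
    exact QuotientGroup.eq.2 (hF _ _ h)
  exact Subgroup.finiteIndex_of_finite_quotient

/-- The homomorphism given by the sum of the reductions mod `p` of the values of `l` on the rescaled
coefficients. -/
noncomputable def dilationHom (ρ : G →* A⟦X⟧) (p D : ℕ) (hρ : ∀ g, coeff 0 (ρ g) = 1) (hp : p ≠ 0)
    (l : A →+ ℤ) : dilationSubgroup ρ p D hρ →* Multiplicative (ZMod p) :=
  MonoidHom.mk' (fun g => Multiplicative.ofAdd
    (∑ a ∈ Finset.Ico 1 D, ((l (coeff a (ρ g)) / (p ^ (D - a) : ℕ) : ℤ) : ZMod p))) <| by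
    rintro ⟨g, hg⟩ ⟨h, hh⟩
    rw [← ofAdd_add, ← Finset.sum_add_distrib]
    refine congrArg _ (Finset.sum_congr rfl fun a ha => ?_)
    obtain ⟨ha, haD⟩ := Finset.mem_Ico.1 ha
    have hgh : ρ (g * h) = (ρ g - 1) * (ρ h - 1) + (ρ g + ρ h - 1) := by
      rw [map_mul]; noncomm_ring
    have hdvd : ((p ^ (D - a + 1) : ℕ) : A) ∣ coeff a ((ρ g - 1) * (ρ h - 1)) := by
      refine dvd_coeff_sub_one_mul (hρ g) fun i j hi hij => ?_
      rcases Nat.eq_zero_or_pos j with rfl | hj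
      · right
        rw [map_sub, hρ]
        simp
      · left
        exact (Nat.cast_dvd_cast (pow_dvd_pow p (by omega))).trans (hg i hi)
    obtain ⟨x, hx⟩ := l.natCast_dvd_map hdvd
    obtain ⟨y, hy⟩ := l.natCast_dvd_map (hg a ha)
    obtain ⟨z, hz⟩ := l.natCast_dvd_map (hh a ha)
    have h0 : ((p ^ (D - a) : ℕ) : ℤ) ≠ 0 := by exact_mod_cast pow_ne_zero _ hp
    have : l (coeff a (ρ (g * h))) = (p ^ (D - a) : ℕ) * (p * x + y + z) := by
      rw [hgh, map_add, map_add, hx, map_sub, map_add, coeff_one, if_neg (by omega), sub_zero,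
        map_add, hy, hz]
      push_cast
      ring
    simp only [MulMemClass.mk_mul_mk]
    rw [this, hy, hz, Int.mul_ediv_cancel_left _ h0, Int.mul_ediv_cancel_left _ h0,
      Int.mul_ediv_cancel_left _ h0]
    simp

theorem exists_least_pow_mem_dilationSubgroup (hp : p.Prime) (hDp : D ≤ p) (l : A →+ ℤ) {g : G}
    {r : ℕ} (hrD : r < D) (hr : 1 ≤ r) (hg : ∀ i < r, coeff i (ρ g - 1) = 0)
    (hpl : ¬ (p : ℤ) ∣ l (coeff r (ρ g - 1))) (t : G) :
    ∃ n : ℕ, 0 < n ∧ ∃ hmem : t * g ^ n * t⁻¹ ∈ dilationSubgroup ρ p D hρ,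
      (∀ n' : ℕ, 0 < n' → t * g ^ n' * t⁻¹ ∈ dilationSubgroup ρ p D hρ → n ≤ n') ∧
      dilationHom ρ p D hρ hp.ne_zero l ⟨t * g ^ n * t⁻¹, hmem⟩ ≠ 1 := by
  have hconj : ∀ n : ℕ, ρ (t * g ^ n * t⁻¹) = 1 + ρ t * (ρ g ^ n - 1) * ρ t⁻¹ := fun n => by
    rw [mul_sub, sub_mul, mul_one, ← map_mul ρ t t⁻¹, mul_inv_cancel, map_one, map_mul, map_mul,
      map_pow]
    noncomm_ring
  have hlow : ∀ n a : ℕ, 1 ≤ a → a ≤ r →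
      coeff a (ρ (t * g ^ n * t⁻¹)) = (n : A) * coeff a (ρ g - 1) := by
    intro n a ha har
    have h1 : ∀ i ≤ r, coeff i (ρ t * (ρ g ^ n - 1)) = (n : A) * coeff i (ρ g - 1) := by
      intro i hi
      rw [coeff_mul_of_forall_lt_right (l := r) _ hi, hρ, one_mul, coeff_pow_sub_one hr hg hi]
      intro j hj
      rw [coeff_pow_sub_one hr hg hj.le, hg j hj, mul_zero]
    rw [hconj, map_add, coeff_one, if_neg (by omega), zero_add,
      coeff_mul_of_forall_lt_left (l := r) _ har, hρ, mul_one, h1 a har]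
    intro j hj
    rw [h1 j hj.le, hg j hj, mul_zero]
  have hhigh : ∀ a, 1 ≤ a → a < D →
      ((p ^ (D - r) : ℕ) : A) ∣ coeff a (ρ (t * g ^ p ^ (D - r) * t⁻¹)) := by
    intro a ha haD
    rw [hconj, map_add, coeff_one, if_neg (by omega), zero_add]
    refine dvd_coeff_mul fun i j hij => Dvd.dvd.mul_right (dvd_coeff_mul fun i' j' hij' => ?_) _
    exact Nat.cast_dvd_mul_of_dvd_right _
      (dvd_coeff_prime_pow_pow_sub_one (hρ g) hp _ (by omega))
  have hmem : t * g ^ p ^ (D - r) * t⁻¹ ∈ dilationSubgroup ρ p D hρ := by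
    intro a ha
    rcases lt_or_ge a r with har | har
    · rw [hlow _ a ha har.le, hg a har, mul_zero]
      exact dvd_zero _
    · rcases lt_or_ge a D with haD | haD
      · exact (Nat.cast_dvd_cast (pow_dvd_pow p (by omega))).trans (hhigh a ha haD)
      · simp [Nat.sub_eq_zero_of_le haD]
  refine ⟨p ^ (D - r), pow_pos hp.pos _, hmem, fun n hn hn' => ?_, fun h1 => hpl ?_⟩
  · have h1 := l.natCast_dvd_map (hn' r hr)
    rw [hlow n r hr le_rfl, ← nsmul_eq_mul, map_nsmul, nsmul_eq_mul] at h1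
    have hc : IsCoprime ((p ^ (D - r) : ℕ) : ℤ) (l (coeff r (ρ g - 1))) := by
      rw [Nat.cast_pow]
      exact ((Nat.prime_iff_prime_int.1 hp).coprime_iff_not_dvd.2 hpl).pow_left
    exact Nat.le_of_dvd hn (by exact_mod_cast hc.dvd_of_dvd_mul_right h1)
  · have h0 : ∀ w, ((p ^ w : ℕ) : ℤ) ≠ 0 := fun w => by exact_mod_cast pow_ne_zero _ hp.ne_zero
    have h2 : ∑ a ∈ Finset.Ico 1 D, ((l (coeff a (ρ (t * g ^ p ^ (D - r) * t⁻¹))) /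
        (p ^ (D - a) : ℕ) : ℤ) : ZMod p) = 0 := Multiplicative.ofAdd.injective h1
    rw [Finset.sum_eq_single r, hlow _ r hr le_rfl, ← nsmul_eq_mul, map_nsmul, nsmul_eq_mul,
      Int.mul_ediv_cancel_left _ (h0 _)] at h2
    · exact (ZMod.intCast_zmod_eq_zero_iff_dvd _ _).1 h2
    · intro a ha har
      obtain ⟨ha, haD⟩ := Finset.mem_Ico.1 ha
      rw [ZMod.intCast_zmod_eq_zero_iff_dvd]
      rcases lt_or_gt_of_ne har with har | har
      · rw [hlow _ a ha har.le, hg a har, mul_zero, map_zero, Int.zero_ediv]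
        exact dvd_zero _
      · obtain ⟨x, hx⟩ := l.natCast_dvd_map
          ((Nat.cast_dvd_cast (pow_dvd_pow p (by omega : D - a + 1 ≤ D - r))).trans (hhigh a ha haD))
        rw [hx, pow_succ, Nat.cast_mul, mul_assoc, Int.mul_ediv_cancel_left _ (h0 _)]
        exact dvd_mul_right _ _
    · intro h
      exact absurd (Finset.mem_Ico.2 ⟨hr, hrD⟩) h

end Dilation

/-- Finitely many nonzero elements of a finitely generated free abelian group can be mapped to
nonzero integers by a single homomorphism. -/
theorem exists_addMonoidHom_int_forall_apply_ne_zero {M ι : Type*} [AddCommGroup M]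
    [Module.Free ℤ M] [Module.Finite ℤ M] [Fintype ι] (v : ι → M) (hv : ∀ i, v i ≠ 0) :
    ∃ l : M →+ ℤ, ∀ i, l (v i) ≠ 0 := by
  classical
  let b := Module.Free.chooseBasis ℤ M
  let q : ι → MvPolynomial (Module.Free.ChooseBasisIndex ℤ M) ℤ :=
    fun i => ∑ k, MvPolynomial.C (b.repr (v i) k) * MvPolynomial.X k
  have hq : ∀ i, q i ≠ 0 := by
    intro i hi
    apply hv i
    apply b.repr.injective
    ext k
    have := congrArg (MvPolynomial.eval (Pi.single k 1)) hi
    simpa [q, Pi.single_apply] using this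
  have hprod : ∏ i, q i ≠ 0 := Finset.prod_ne_zero_iff.2 fun i _ => hq i
  obtain ⟨x, hx⟩ : ∃ x, MvPolynomial.eval x (∏ i, q i) ≠ 0 := by
    by_contra! h
    exact hprod (MvPolynomial.funext fun x => by rw [h, map_zero])
  rw [map_prod, Finset.prod_ne_zero_iff] at hx
  refine ⟨(b.constr ℤ x).toAddMonoidHom, fun i => ?_⟩
  have := hx i (Finset.mem_univ i)
  simpa [q, Module.Basis.constr_apply_fintype] using this

/-- A group with a representation by power series with constant term `1` over a ring whose additive
group is free of finite rank has a finite-index subgroup with a homomorphism to a cyclic group of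
prime order that is nonzero on all elevations of finitely many elements acting nontrivially. -/
theorem exists_finiteIndex_hom_zmod_ne_one_of_powerSeries {G A ι : Type*} [Group G] [Ring A]
    [Module.Free ℤ A] [Module.Finite ℤ A] [Fintype ι] (ρ : G →* A⟦X⟧)
    (hρ : ∀ g, coeff 0 (ρ g) = 1) (g : ι → G) (hg : ∀ i, ρ (g i) ≠ 1) :
    ∃ (K : Subgroup G) (p : ℕ), K.FiniteIndex ∧ p.Prime ∧ 3 ≤ p ∧
      ∃ φ : K →* Multiplicative (ZMod p), ∀ (i : ι) (t : G),
        ∃ n : ℕ, 0 < n ∧ ∃ hmem : t * (g i) ^ n * t⁻¹ ∈ K,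
          (∀ n' : ℕ, 0 < n' → t * (g i) ^ n' * t⁻¹ ∈ K → n ≤ n') ∧
          φ (⟨t * (g i) ^ n * t⁻¹, hmem⟩ : K) ≠ 1 := by
  classical
  have hex : ∀ i, ∃ r, coeff r (ρ (g i) - 1) ≠ 0 := fun i =>
    exists_coeff_ne_zero_iff_ne_zero.2 (sub_ne_zero.2 (hg i))
  let r : ι → ℕ := fun i => Nat.find (hex i)
  have hr : ∀ i, coeff (r i) (ρ (g i) - 1) ≠ 0 := fun i => Nat.find_spec (hex i)
  have hlt : ∀ i, ∀ j < r i, coeff j (ρ (g i) - 1) = 0 := fun i j hj =>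
    not_not.1 (Nat.find_min (hex i) hj)
  have hpos : ∀ i, 1 ≤ r i := by
    intro i
    by_contra h
    have h0 : r i = 0 := by omega
    apply hr i
    rw [h0, map_sub, hρ]
    simp
  obtain ⟨l, hl⟩ := exists_addMonoidHom_int_forall_apply_ne_zero _ hr
  let D := ∑ i, r i + 1
  have hD : ∀ i, r i < D := fun i =>
    Nat.lt_succ_of_le (Finset.single_le_sum (f := r) (fun _ _ => Nat.zero_le _) (Finset.mem_univ i))
  let B := ∑ i, (l (coeff (r i) (ρ (g i) - 1))).natAbs
  obtain ⟨p, hle, hp⟩ := Nat.exists_infinite_primes (3 + D + B)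
  refine ⟨dilationSubgroup ρ p D hρ, p, dilationSubgroup_finiteIndex hp.ne_zero, hp, by omega,
    dilationHom ρ p D hρ hp.ne_zero l, fun i t => ?_⟩
  refine exists_least_pow_mem_dilationSubgroup hp (by omega) l (hD i) (hpos i) (hlt i) ?_ t
  intro hdvd
  have hB : (l (coeff (r i) (ρ (g i) - 1))).natAbs ≤ B :=
    Finset.single_le_sum (f := fun i => (l (coeff (r i) (ρ (g i) - 1))).natAbs)
      (fun _ _ => Nat.zero_le _) (Finset.mem_univ i)
  refine hl i (Int.eq_zero_of_dvd_of_natAbs_lt_natAbs hdvd ?_)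
  rw [Int.natAbs_natCast]
  omega

/-- A family of power series as a power series over the product ring. -/
noncomputable def PowerSeries.piHom {ι : Type*} (A : ι → Type*) [∀ i, Ring (A i)] :
    (∀ i, (A i)⟦X⟧) →* (∀ i, A i)⟦X⟧ where
  toFun s := PowerSeries.mk fun n i => coeff n (s i)
  map_one' := by
    ext n i
    by_cases h : n = 0 <;> simp [coeff_one, h]
  map_mul' s t := by
    ext n i
    simp [coeff_mul]

section FreeGroup

/-- The endomorphisms `(a, b) ↦ (b, 0)` and `(a, b) ↦ (0, a)` of `ℤ × ℤ`. -/
def shear : Fin 2 → Module.End ℤ (ℤ × ℤ) :=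
  ![LinearMap.inl ℤ ℤ ℤ ∘ₗ LinearMap.snd ℤ ℤ ℤ, LinearMap.inr ℤ ℤ ℤ ∘ₗ LinearMap.fst ℤ ℤ ℤ]

theorem shear_mul_self (i : Fin 2) : shear i * shear i = 0 := by
  ext <;> fin_cases i <;> simp [shear]

/-- The unit `1 + x` for `x` of square zero. -/
def unitOneAdd {R : Type*} [Ring R] (x : R) (hx : x * x = 0) : Rˣ where
  val := 1 + x
  inv := 1 - x
  val_inv := by simp [mul_sub, add_mul, hx]
  inv_val := by simp [mul_add, sub_mul, hx]

/-- The region to which the generator `x.1` (or its inverse, depending on `x.2`) pushes points. -/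
def pingPongRegion (x : Fin 2 × Bool) : Set (ℤ × ℤ) :=
  {v | (if x.1 = 0 then v.2.natAbs < v.1.natAbs else v.1.natAbs < v.2.natAbs) ∧
    (if x.2 then 0 < v.1 * v.2 else v.1 * v.2 < 0)}

theorem one_add_three_mul_shear_mem_pingPongRegion {x : Fin 2 × Bool} {v : ℤ × ℤ}
    (hv : v = (1, 1) ∨ ∃ y : Fin 2 × Bool, (x.1 = y.1 → x.2 = y.2) ∧ v ∈ pingPongRegion y)
    {u : Fin 2 → (Module.End ℤ (ℤ × ℤ))ˣ} (hu : ∀ i, (u i).1 = 1 + 3 * shear i)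
    (hu' : ∀ i, (u i)⁻¹.1 = 1 - 3 * shear i) :
    (cond x.2 (u x.1) (u x.1)⁻¹).1 v ∈ pingPongRegion x := by
  have h0 : ∀ v : ℤ × ℤ, (3 * shear 0) v = (3 * v.2, 0) := fun v => by
    rw [Module.End.mul_apply]
    simp [shear, Module.End.ofNat_apply]
  have h1 : ∀ v : ℤ × ℤ, (3 * shear 1) v = (0, 3 * v.1) := fun v => by
    rw [Module.End.mul_apply]
    simp [shear, Module.End.ofNat_apply]
  obtain ⟨a, b⟩ := v
  obtain ⟨i, β⟩ := x
  fin_cases i <;> cases β <;>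
  · simp only [cond_true, cond_false, hu, hu', Fin.zero_eta, Fin.mk_one, LinearMap.add_apply,
      LinearMap.sub_apply, Module.End.one_apply, h0, h1]
    rcases hv with hv | ⟨⟨j, γ⟩, hy, hv⟩
    · obtain ⟨rfl, rfl⟩ := Prod.mk.inj hv
      simp [pingPongRegion]
    · fin_cases j <;> cases γ <;>
        simp [pingPongRegion, mul_pos_iff, mul_neg_iff] at hy hv ⊢ <;> omega

/-- Sanov's theorem: `1 + 3 * shear 0` and `1 + 3 * shear 1` freely generate a free group. -/
theorem lift_one_add_three_mul_shear_ne_one {u : Fin 2 → (Module.End ℤ (ℤ × ℤ))ˣ}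
    (hu : ∀ i, (u i).1 = 1 + 3 * shear i) (hu' : ∀ i, (u i)⁻¹.1 = 1 - 3 * shear i)
    {w : FreeGroup (Fin 2)} (hw : w ≠ 1) :
    FreeGroup.lift u w ≠ 1 := by
  have key : ∀ (L : List (Fin 2 × Bool)) (x : Fin 2 × Bool), FreeGroup.IsReduced (x :: L) →
      (((x :: L).map fun x => cond x.2 (u x.1) (u x.1)⁻¹).prod).1 (1, 1) ∈ pingPongRegion x := by
    intro L
    induction L with
    | nil =>
      intro x _
      simpa using one_add_three_mul_shear_mem_pingPongRegion (x := x) (Or.inl rfl) hu hu'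
    | cons y L ih =>
      intro x hx
      rw [FreeGroup.isReduced_cons_cons] at hx
      rw [List.map_cons, List.prod_cons, Units.val_mul, Module.End.mul_apply]
      exact one_add_three_mul_shear_mem_pingPongRegion (Or.inr ⟨y, hx.1, ih y hx.2⟩) hu hu'
  intro h
  have hred := FreeGroup.isReduced_toWord (x := w)
  rw [← FreeGroup.mk_toWord (x := w), FreeGroup.lift_mk] at h
  cases hL : w.toWord with
  | nil => exact hw (FreeGroup.toWord_eq_nil_iff.1 hL)
  | cons x L =>
    rw [hL] at h hred
    have := (key L x hred).1
    rw [h] at this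
    simp at this

open Polynomial in
/-- A Magnus-type embedding of the free group of rank two. -/
theorem exists_hom_powerSeries_ne_one :
    ∃ σ : FreeGroup (Fin 2) →* (Module.End ℤ (ℤ × ℤ))⟦X⟧,
      (∀ w, coeff 0 (σ w) = 1) ∧ ∀ w, w ≠ 1 → σ w ≠ 1 := by
  let B := Module.End ℤ (ℤ × ℤ)
  have hsq : ∀ i, (Polynomial.C (shear i) * Polynomial.X : B[X]) *
      (Polynomial.C (shear i) * Polynomial.X) = 0 := by
    intro i
    rw [mul_assoc, ← mul_assoc Polynomial.X, Polynomial.X_mul_C, mul_assoc, ← mul_assoc,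
      ← Polynomial.C_mul, shear_mul_self, map_zero, zero_mul]
  let s : FreeGroup (Fin 2) →* B[X]ˣ := FreeGroup.lift fun i => unitOneAdd _ (hsq i)
  let ev : B[X] →+* B :=
    Polynomial.eval₂RingHom' (RingHom.id B) 3 fun a => (Nat.cast_commute 3 a).symm
  have hev : (Units.map (ev : B[X] →* B)).comp s =
      FreeGroup.lift fun i => Units.map (ev : B[X] →* B) (unitOneAdd _ (hsq i)) := by
    ext i : 1
    simp [s]
  refine ⟨(Polynomial.coeToPowerSeries.ringHom : B[X] →+* B⟦X⟧).toMonoidHom.comp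
    ((Units.coeHom _).comp s), fun w => ?_, fun w hw h => ?_⟩
  · have h1 : (Units.map ((Polynomial.constantCoeff : B[X] →+* B) : B[X] →* B)).comp s = 1 := by
      ext i : 1
      ext1
      simp [s, unitOneAdd]
    have h2 := congrArg Units.val (DFunLike.congr_fun h1 w)
    change PowerSeries.coeff 0 ((s w : B[X]) : B⟦X⟧) = 1
    rw [Polynomial.coeff_coe]
    exact h2
  · have h1 : s w = 1 := by
      ext1
      exact Polynomial.coe_injective B (by simpa using h)
    refine lift_one_add_three_mul_shear_ne_one
      (u := fun i => Units.map (ev : B[X] →* B) (unitOneAdd _ (hsq i)))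
      ?_ ?_ hw ?_
    · intro i
      simpa [ev, unitOneAdd] using (Nat.cast_commute 3 (shear i)).eq.symm
    · intro i
      simpa [ev, unitOneAdd] using (Nat.cast_commute 3 (shear i)).eq.symm
    · rw [← hev, MonoidHom.comp_apply, h1, map_one]

end FreeGroup

/-- Let `G` be a finitely generated residually free group and let
`g 1, ..., g m` be finitely many nontrivial elements of `G`.  Then there are a
finite-index subgroup `K ≤ G`, a prime `p ≥ 3`, and a homomorphism `φ : K → ℤ/pℤ`
such that for every `i` and every `t ∈ G`: there is a positive integer `n` with
`t * (g i)^n * t⁻¹ ∈ K`, and if `n` is the least such positive integer then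
`φ (t * (g i)^n * t⁻¹)` is nonzero. -/
theorem exists_finite_index_subgroup_and_hom_to_zmod_p_nonzero_on_elevations
    {G : Type*} [Group G] (hfg : Group.FG G)
    (hrf : ∀ g : G, g ≠ 1 → ∃ f : G →* FreeGroup (Fin 2), f g ≠ 1)
    (m : ℕ) (g : Fin m → G) (hg : ∀ i, g i ≠ 1) :
    ∃ (K : Subgroup G) (p : ℕ), K.FiniteIndex ∧ p.Prime ∧ 3 ≤ p ∧
      ∃ φ : K →* Multiplicative (ZMod p),
        ∀ (i : Fin m) (t : G),
          ∃ n : ℕ, 0 < n ∧ ∃ hmem : t * (g i) ^ n * t⁻¹ ∈ K,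
            (∀ n' : ℕ, 0 < n' → t * (g i) ^ n' * t⁻¹ ∈ K → n ≤ n') ∧
            φ (⟨t * (g i) ^ n * t⁻¹, hmem⟩ : K) ≠ 1 := by
  choose f hf using fun i => hrf (g i) (hg i)
  obtain ⟨σ, hσ, hσ'⟩ := exists_hom_powerSeries_ne_one
  refine exists_finiteIndex_hom_zmod_ne_one_of_powerSeries
    ((PowerSeries.piHom fun _ : Fin m => Module.End ℤ (ℤ × ℤ)).comp
      (MonoidHom.pi fun i => σ.comp (f i))) (fun x => ?_) g fun i h => hσ' _ (hf i) ?_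
  · ext1 i
    simpa [PowerSeries.piHom] using hσ (f i x)
  · ext1 n
    have := congrFun (congrArg (coeff n) h) i
    by_cases hn : n = 0 <;> simpa [PowerSeries.piHom, coeff_one, hn] using this
end

section
/- Let G be a finitely generated residually free group and let g_1, ..., g_m be finitely many nontrivial elements of G. Then there exist a finite-index subgroup K of G and a group homomorphism ψ from K to the infinite cyclic group ℤ such that ψ(k) is nonzero for every element k of K of the form k = t * g_i^n * t^{-1} (for some index i, some t in G, and some nonzero integer n). -/
/-- An element `g` is virtually detected by `ℤ` if it lies in a finite-index subgroup admitting
a homomorphism to `ℤ` that does not vanish at `g`. -/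
def VirtuallyDetected {G : Type*} [Group G] (g : G) : Prop :=
  ∃ H : Subgroup G, H.FiniteIndex ∧ ∃ φ : H →* Multiplicative ℤ, ∃ hg : g ∈ H, φ ⟨g, hg⟩ ≠ 1

theorem Subgroup.finiteIndex_comap {G G' : Type*} [Group G] [Group G'] (H : Subgroup G')
    [H.FiniteIndex] (f : G →* G') : (H.comap f).FiniteIndex := by
  have := H.isFiniteRelIndex_of_finiteIndex (K := f.range)
  exact ⟨by rw [Subgroup.index_comap]; exact Subgroup.relIndex_ne_zero⟩

theorem VirtuallyDetected.of_map {G G' : Type*} [Group G] [Group G'] (f : G →* G') {g : G}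
    (h : VirtuallyDetected (f g)) : VirtuallyDetected g := by
  obtain ⟨H, hH, φ, hg, hφ⟩ := h
  exact ⟨H.comap f, H.finiteIndex_comap f, φ.comp (f.subgroupComap H), hg, hφ⟩

/-- If the letters of a cyclic word never cancel with their successors, then the partial
injections by which a generator acts on the corresponding labelled cycle extend to a
permutation of the vertices of the cycle. -/
theorem exists_perm_extending_cycle_edges {α : Type*} {n : ℕ} [NeZero n] (w : ZMod n → α × Bool)
    (hw : ∀ i, (w i).1 = (w (i + 1)).1 → (w i).2 = (w (i + 1)).2) (a : α) :
    ∃ σ : Equiv.Perm (ZMod n), (∀ j, w j = (a, true) → σ (j + 1) = j) ∧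
      ∀ j, w j = (a, false) → σ j = j + 1 := by
  classical
  let s : Set (ZMod n) := {v | w (v - 1) = (a, true) ∨ w v = (a, false)}
  let f : ZMod n → ZMod n := fun v => if w (v - 1) = (a, true) then v - 1 else v + 1
  have key : ∀ j, w j = (a, true) → w (j + 1) ≠ (a, false) := by
    intro j h1 h2
    have := hw j
    simp [h1, h2] at this
  have hf : Set.InjOn f s := by
    intro u hu v hv huv
    by_cases h1 : w (u - 1) = (a, true) <;> by_cases h2 : w (v - 1) = (a, true)
    · simpa [f, h1, h2] using huv
    · have h3 : w v = (a, false) := hv.resolve_left h2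
      simp only [f, h1, h2, if_true, if_false] at huv
      rw [huv] at h1
      have := hw v
      simp [h1, h3] at this
    · have h3 : w u = (a, false) := hu.resolve_left h1
      simp only [f, h1, h2, if_true, if_false] at huv
      rw [← huv] at h2
      have := hw u
      simp [h2, h3] at this
    · simpa [f, h1, h2] using huv
  obtain ⟨e, he⟩ := Set.MapsTo.exists_equiv_extend_of_card_eq (t := Finset.univ)
    Finset.card_univ.symm (s := s) (f := f) (fun _ _ => by simp) hf
  refine ⟨e.trans (Equiv.subtypeUnivEquiv Finset.mem_univ), fun j hj => ?_, fun j hj => ?_⟩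
  · have : j + 1 ∈ s := Or.inl (by simpa using hj)
    simpa [f, hj] using he _ this
  · have hs : j ∈ s := Or.inr hj
    have h1 : w (j - 1) ≠ (a, true) := fun h => key _ h (by simpa using hj)
    simpa [f, h1] using he _ hs

/-- The permutation of `X × ℤ` that acts by `σ` on `X` and translates the fibre over `x`
by `c x`. -/
def Equiv.Perm.skewTranslation {X : Type*} (σ : Equiv.Perm X) (c : X → ℤ) :
    Equiv.Perm (X × ℤ) where
  toFun p := (σ p.1, p.2 + c p.1)
  invFun p := (σ.symm p.1, p.2 - c (σ.symm p.1))
  left_inv p := by simp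
  right_inv p := by simp

theorem FreeGroup.lift_skewTranslation_apply {α X : Type*} (σ : α → Equiv.Perm X)
    (c : α → X → ℤ) (g : FreeGroup α) (x : X) (k : ℤ) :
    FreeGroup.lift (fun a => (σ a).skewTranslation (c a)) g (x, k) =
      (FreeGroup.lift σ g x,
        k + (FreeGroup.lift (fun a => (σ a).skewTranslation (c a)) g (x, 0)).2) := by
  induction g using FreeGroup.induction_on generalizing x k with
  | C1 => simp
  | of a => simp [Equiv.Perm.skewTranslation]
  | inv_of a ih =>
    simp only [_root_.map_inv, FreeGroup.lift_apply_of, Equiv.Perm.inv_def]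
    simp [Equiv.Perm.skewTranslation, sub_eq_add_neg]
  | mul g h ihg ihh =>
    simp only [_root_.map_mul, Equiv.Perm.mul_apply]
    rw [ihh x k, ihh x 0, ihg, ihg _ (0 + _)]
    simp [add_assoc]

/-- A group element whose word traverses a labelled cycle once is virtually detected. -/
theorem FreeGroup.virtuallyDetected_of_cycle {α : Type*} {n : ℕ} [NeZero n]
    (w : ZMod n → α × Bool)
    (hw : ∀ i, (w i).1 = (w (i + 1)).1 → (w i).2 = (w (i + 1)).2) :
    VirtuallyDetected (FreeGroup.mk ((List.range n).map fun i : ℕ => w i)) := by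
  classical
  choose σ hσ₁ hσ₂ using exists_perm_extending_cycle_edges w hw
  let c : α → ZMod n → ℤ := fun a v =>
    if w (v - 1) = (a, true) then 1 else if w v = (a, false) then -1 else 0
  let F := FreeGroup.lift (fun a => (σ a).skewTranslation (c a))
  have hF : ∀ g x k, F g (x, k) = (FreeGroup.lift σ g x, k + (F g (x, 0)).2) :=
    FreeGroup.lift_skewTranslation_apply σ c
  have step : ∀ (j : ZMod n) (k : ℤ), F (FreeGroup.mk [w j]) (j + 1, k) = (j, k + 1) := by
    intro j k
    rcases h : w j with ⟨a, b⟩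
    cases b
    · have h1 : w (j - 1) ≠ (a, true) := fun h' => by
        have := hw (j - 1)
        simp [h', h] at this
      have : (σ a).skewTranslation (c a) (j, k + 1) = (j + 1, k) := by
        simp [Equiv.Perm.skewTranslation, hσ₂ a j h, c, h1, h]
      simp only [F, FreeGroup.lift_mk]
      simp [← this, Equiv.Perm.inv_def]
    · simp only [F, FreeGroup.lift_mk]
      simp [Equiv.Perm.skewTranslation, hσ₁ a j h, c, h]
  have walk : ∀ (m : ℕ) (k : ℤ),
      F (FreeGroup.mk ((List.range m).map fun i : ℕ => w i)) ((m : ZMod n), k) = (0, k + m) := by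
    intro m
    induction m with
    | zero => intro k; simp [← FreeGroup.one_eq_mk]
    | succ m ih =>
      intro k
      rw [List.range_succ, List.map_append, ← FreeGroup.mul_mk, _root_.map_mul, Equiv.Perm.mul_apply,
        List.map_singleton, Nat.cast_succ, step, ih]
      push_cast
      ring_nf
  have loop := walk n 0
  rw [ZMod.natCast_self, zero_add] at loop
  let H : Subgroup (FreeGroup α) :=
    (MulAction.stabilizer (Equiv.Perm (ZMod n)) (0 : ZMod n)).comap (FreeGroup.lift σ)
  have hH : ∀ g ∈ H, FreeGroup.lift σ g 0 = 0 := fun g hg => hg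
  let φ : H →* Multiplicative ℤ :=
    { toFun := fun g => Multiplicative.ofAdd (F g (0, 0)).2
      map_one' := by simp
      map_mul' := fun g h => by
        rw [← ofAdd_add, Subgroup.coe_mul, _root_.map_mul, Equiv.Perm.mul_apply, hF h, hH h h.2, hF g]
        simp [add_comm] }
  refine ⟨H, Subgroup.finiteIndex_comap _ _, φ, ?_, ?_⟩
  · have := congrArg Prod.fst loop
    rwa [hF] at this
  · change Multiplicative.ofAdd (F _ (0, 0)).2 ≠ 1
    rw [loop]
    simpa using NeZero.ne n

theorem FreeGroup.IsCyclicallyReduced.virtuallyDetected {α : Type*} {L : List (α × Bool)}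
    (hL : FreeGroup.IsCyclicallyReduced L) (hne : L ≠ []) :
    VirtuallyDetected (FreeGroup.mk L) := by
  have hpos : 0 < L.length := List.length_pos_iff.mpr hne
  have : NeZero L.length := ⟨hpos.ne'⟩
  let w : ZMod L.length → α × Bool := fun j => L[j.val]'(ZMod.val_lt j)
  have hword : (List.range L.length).map (fun i : ℕ => w i) = L := by
    apply List.ext_getElem
    · simp
    · intro i h1 h2
      simp [w, ZMod.val_natCast, Nat.mod_eq_of_lt h2]
  rw [← hword]
  refine FreeGroup.virtuallyDetected_of_cycle w fun j => ?_
  have hj := ZMod.val_lt j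
  have hsucc : (j + 1).val = (j.val + 1) % L.length := by
    conv_lhs => rw [← ZMod.natCast_zmod_val j, ← Nat.cast_succ, ZMod.val_natCast]
  rcases Nat.lt_or_ge (j.val + 1) L.length with h | h
  · rw [Nat.mod_eq_of_lt h] at hsucc
    simp only [w, hsucc]
    exact List.isChain_iff_getElem.mp hL.1 j.val h
  · have hlast : j.val = L.length - 1 := by omega
    have h0 : (j.val + 1) % L.length = 0 := by
      rw [show j.val + 1 = L.length by omega, Nat.mod_self]
    rw [h0] at hsucc
    simp only [w, hsucc, hlast]
    exact hL.2 _ (by rw [List.getLast?_eq_getElem?]; simp) _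
      (by rw [List.head?_eq_getElem?]; simp [hpos])

theorem FreeGroup.virtuallyDetected {α : Type*} {g : FreeGroup α} (hg : g ≠ 1) :
    VirtuallyDetected g := by
  classical
  let u := FreeGroup.mk (FreeGroup.reduceCyclically.conjugator g.toWord)
  let L := FreeGroup.reduceCyclically g.toWord
  have hconj : g = u * FreeGroup.mk L * u⁻¹ := by
    rw [FreeGroup.inv_mk, FreeGroup.mul_mk, FreeGroup.mul_mk,
      FreeGroup.reduceCyclically.conj_conjugator_reduceCyclically, FreeGroup.mk_toWord]
  have hne : L ≠ [] := by
    intro h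
    apply hg
    rw [hconj, h, ← FreeGroup.one_eq_mk]
    simp
  have hL : FreeGroup.IsCyclicallyReduced L :=
    FreeGroup.reduceCyclically.isCyclicallyReduced FreeGroup.isReduced_toWord
  refine .of_map (MulAut.conj u⁻¹).toMonoidHom ?_
  have : (MulAut.conj u⁻¹).toMonoidHom g = FreeGroup.mk L := by
    rw [hconj]
    simp [mul_assoc]
  rw [this]
  exact hL.virtuallyDetected hne

/-- Finitely many elements that are individually detected by homomorphisms to `ℤ` are
simultaneously detected by a single one. -/
theorem Finset.exists_hom_int_ne_one {K : Type*} [Group K] (s : Finset K)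
    (hs : ∀ v ∈ s, ∃ φ : K →* Multiplicative ℤ, φ v ≠ 1) :
    ∃ ψ : K →* Multiplicative ℤ, ∀ v ∈ s, ψ v ≠ 1 := by
  classical
  induction s using Finset.induction_on with
  | empty => exact ⟨1, by simp⟩
  | insert v s _ ih =>
    obtain ⟨ψ, hψ⟩ := ih fun u hu => hs u (Finset.mem_insert_of_mem hu)
    obtain ⟨φ, hφ⟩ := hs v (Finset.mem_insert_self v s)
    obtain ⟨c, hc⟩ := Infinite.exists_notMem_finset
      ((insert v s).image fun u => -(φ u).toAdd / (ψ u).toAdd)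
    refine ⟨φ * ψ ^ c, fun u hu h => ?_⟩
    have heq : (φ u).toAdd + c * (ψ u).toAdd = 0 := by
      simpa using congrArg Multiplicative.toAdd h
    by_cases h0 : (ψ u).toAdd = 0
    · rw [h0, mul_zero, add_zero] at heq
      rcases Finset.mem_insert.mp hu with rfl | hu
      · exact hφ heq
      · exact hψ u hu h0
    · refine hc (Finset.mem_image.mpr ⟨u, hu, ?_⟩)
      rw [show -(φ u).toAdd = c * (ψ u).toAdd by linarith, Int.mul_ediv_cancel _ h0]

/-- Finitely many virtually detected elements are detected simultaneously, together with all
conjugates of their powers, on a common finite-index subgroup. -/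
theorem VirtuallyDetected.exists_common {G ι : Type*} [Group G] [Finite ι] {g : ι → G}
    (hg : ∀ i, VirtuallyDetected (g i)) :
    ∃ K : Subgroup G, K.FiniteIndex ∧ ∃ ψ : K →* Multiplicative ℤ,
      ∀ (i : ι) (t : G) (n : ℤ), n ≠ 0 → ∀ hk : t * g i ^ n * t⁻¹ ∈ K,
        ψ ⟨t * g i ^ n * t⁻¹, hk⟩ ≠ 1 := by
  classical
  choose H hfin φ hmem hφ using hg
  have : (⨅ i, H i).FiniteIndex := Subgroup.finiteIndex_iInf hfin
  let K : Subgroup G := (⨅ i, H i).normalCore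
  have hK : ∀ i, K ≤ H i := fun i => (Subgroup.normalCore_le _).trans (iInf_le _ i)
  have hN : K.index ≠ 0 := Subgroup.FiniteIndex.index_ne_zero
  have hpow : ∀ i t, t * g i ^ K.index * t⁻¹ ∈ K := fun i t =>
    Subgroup.Normal.conj_mem inferInstance _ (K.pow_index_mem (g i)) t
  let v : ι → G → K := fun i t => ⟨t * g i ^ K.index * t⁻¹, hpow i t⟩
  have hv : ∀ i t, ∃ φ : K →* Multiplicative ℤ, φ (v i t) ≠ 1 := by
    intro i t
    refine ⟨((φ i).comp (Subgroup.inclusion (hK i))).comp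
      (MulAut.conjNormal t⁻¹ : MulAut K).toMonoidHom, ?_⟩
    have : Subgroup.inclusion (hK i) (MulAut.conjNormal t⁻¹ (v i t)) =
        (⟨g i, hmem i⟩ : H i) ^ K.index := by
      ext
      simp [v, mul_assoc]
    change φ i (Subgroup.inclusion (hK i) (MulAut.conjNormal t⁻¹ (v i t))) ≠ 1
    rw [this, map_pow]
    exact fun h => hφ i ((pow_eq_one_iff_left hN).mp h)
  have hfinite : (Set.range fun p : ι × (G ⧸ K) => v p.1 p.2.out).Finite := Set.finite_range _
  obtain ⟨ψ, hψ⟩ := hfinite.toFinset.exists_hom_int_ne_one fun u hu => by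
    obtain ⟨p, rfl⟩ := hfinite.mem_toFinset.mp hu
    exact hv _ _
  have hψv : ∀ i t, ψ (v i t) ≠ 1 := by
    intro i t
    obtain ⟨k, hk⟩ := QuotientGroup.mk_out_eq_mul K t
    let k' : K := MulAut.conjNormal t k
    have : v i (t : G ⧸ K).out = k' * v i t * k'⁻¹ := by
      ext
      simp [v, k', hk, mul_assoc]
    have hne := hψ (v i (t : G ⧸ K).out) (hfinite.mem_toFinset.mpr ⟨(i, t), rfl⟩)
    rw [this] at hne
    simpa using hne
  refine ⟨K, inferInstance, ψ, fun i t n hn hk h => ?_⟩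
  have hcomm : (⟨t * g i ^ n * t⁻¹, hk⟩ : K) ^ K.index = v i t ^ n := by
    ext
    simp only [v, Subgroup.coe_pow, Subgroup.coe_zpow, conj_pow, conj_zpow]
    rw [← zpow_natCast, ← zpow_natCast, ← zpow_mul, ← zpow_mul, mul_comm]
  have h1 : ψ (v i t) ^ n = 1 := by rw [← map_zpow, ← hcomm, map_pow, h, one_pow]
  exact hψv i t ((IsMulTorsionFree.zpow_eq_one_iff_left hn).mp h1)


/-- Let `G` be a finitely generated residually free group and let
`g 1, ..., g m` be finitely many nontrivial elements of `G`.  Then there exist a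
finite-index subgroup `K ≤ G` and a homomorphism `ψ : K → ℤ` such that `ψ k` is
nonzero for every element `k ∈ K` of the form `k = t * (g i)^n * t⁻¹` with `n` a
nonzero integer. -/
theorem exists_finite_index_subgroup_and_hom_to_int_nonzero_on_conjugate_powers
    {G : Type*} [Group G] (hfg : Group.FG G)
    (hrf : ∀ g : G, g ≠ 1 → ∃ f : G →* FreeGroup (Fin 2), f g ≠ 1)
    (m : ℕ) (g : Fin m → G) (hg : ∀ i, g i ≠ 1) :
    ∃ K : Subgroup G, K.FiniteIndex ∧
      ∃ ψ : K →* Multiplicative ℤ,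
        ∀ (i : Fin m) (t : G) (n : ℤ), n ≠ 0 →
          ∀ hk : t * (g i) ^ n * t⁻¹ ∈ K,
            ψ (⟨t * (g i) ^ n * t⁻¹, hk⟩ : K) ≠ 1 := by
  refine VirtuallyDetected.exists_common fun i => ?_
  obtain ⟨f, hf⟩ := hrf (g i) (hg i)
  exact .of_map f (FreeGroup.virtuallyDetected hf)
end
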